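/- Let τ ∈ (0, (1+√5)/2) and let {(y^k, z^k, x^k)}_{k≥0} be a sequence generated by the majorized iPADMM. Then for every KKT point ū = (ȳ, z̄, x̄) ∈ Ω̄ and every k ≥ 1: ‖u^{k+1} − ū‖²_ℳ + ‖z^{k+1} − z^k‖²_{Σ̂_g + 𝒯} ≤ ‖u^k − ū‖²_ℳ + ‖z^k − z^{k−1}‖²_{Σ̂_g + 𝒯} − ‖u^{k+1} − u^k‖²_ℋ. Consequently, with dist²_ℳ(u, Ω̄) := inf_{w ∈ Ω̄} ‖u − w‖²_ℳ, for all k ≥ 1: dist²_ℳ(u^{k+1}, Ω̄) + ‖z^{k+1} − z^k‖²_{Σ̂_g + 𝒯} ≤ dist²_ℳ(u^k, Ω̄) + ‖z^k − z^{k−1}‖²_{Σ̂_g + 𝒯} − ‖u^{k+1} − u^k‖²_ℋ. -/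

import Mathlib

open scoped RealInnerProductSpace

noncomputable section

/-- the quadratic form `‖w‖²_M := ⟨w, M w⟩` of a linear operator. -/
def quadForm {E : Type*} [NormedAddCommGroup E] [InnerProductSpace ℝ E]
    (M : E →ₗ[ℝ] E) (w : E) : ℝ := ⟪w, M w⟫

/-- convexity of a function with values in `ℝ ∪ {±∞}`. -/
def ERConvex {E : Type*} [AddCommGroup E] [Module ℝ E] (p : E → EReal) : Prop :=
  ∀ x y : E, ∀ a b : ℝ, 0 ≤ a → 0 ≤ b → a + b = 1 →
    p (a • x + b • y) ≤ (a : EReal) * p x + (b : EReal) * p y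

/-- properness of a function with values in `ℝ ∪ {±∞}`: nowhere `−∞`, somewhere finite. -/
def ERProper {E : Type*} (p : E → EReal) : Prop :=
  (∃ x, p x ≠ ⊤) ∧ ∀ x, p x ≠ ⊥

/-- `g` belongs to the convex subdifferential `∂p(x)`. -/
def ERSubgrad {E : Type*} [NormedAddCommGroup E] [InnerProductSpace ℝ E]
    (p : E → EReal) (x g : E) : Prop :=
  ∀ w, p x + ((⟪g, w - x⟫ : ℝ) : EReal) ≤ p w

/-- the set `Ω̄` of KKT points of the problem `min p(y) + f(y) + q(z) + g(z)`
subject to `𝒜*y + ℬ*z = c`. -/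
def KKTset {X Y Z : Type*}
    [NormedAddCommGroup X] [InnerProductSpace ℝ X] [FiniteDimensional ℝ X]
    [NormedAddCommGroup Y] [InnerProductSpace ℝ Y] [FiniteDimensional ℝ Y]
    [NormedAddCommGroup Z] [InnerProductSpace ℝ Z] [FiniteDimensional ℝ Z]
    (A : X →ₗ[ℝ] Y) (B : X →ₗ[ℝ] Z) (c : X)
    (gradf : Y → Y) (gradg : Z → Z) (p : Y → EReal) (q : Z → EReal) :
    Set (Y × Z × X) :=
  {u | ERSubgrad p u.1 (-(gradf u.1 + A u.2.2)) ∧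
       ERSubgrad q u.2.1 (-(gradg u.2.1 + B u.2.2)) ∧
       LinearMap.adjoint A u.1 + LinearMap.adjoint B u.2.1 = c}

/-- The polarization identity of a symmetric operator at three points. -/
theorem two_mul_inner_map_sub {E : Type*} [NormedAddCommGroup E] [InnerProductSpace ℝ E]
    {M : E →ₗ[ℝ] E} (hM : M.IsSymmetric) (a b c : E) :
    2 * ⟪M (a - b), a - c⟫
      = quadForm M (a - c) - quadForm M (b - c) + quadForm M (a - b) := by
  have hab := hM a b
  have hac := hM a c
  have hbc := hM b c
  rw [real_inner_comm] at hab hac hbc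
  simp only [quadForm, map_sub, inner_sub_left, inner_sub_right]
  rw [real_inner_comm a (M a), real_inner_comm a (M b), real_inner_comm c (M a),
    real_inner_comm c (M b)]
  linarith

theorem quadForm_add {E : Type*} [NormedAddCommGroup E] [InnerProductSpace ℝ E]
    (M N : E →ₗ[ℝ] E) (w : E) : quadForm (M + N) w = quadForm M w + quadForm N w := by
  simp [quadForm, inner_add_right]

theorem quadForm_smul {E : Type*} [NormedAddCommGroup E] [InnerProductSpace ℝ E]
    (a : ℝ) (M : E →ₗ[ℝ] E) (w : E) : quadForm (a • M) w = a * quadForm M w := by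
  simp [quadForm, inner_smul_right]

theorem quadForm_smul_right {E : Type*} [NormedAddCommGroup E] [InnerProductSpace ℝ E]
    (a : ℝ) (M : E →ₗ[ℝ] E) (w : E) : quadForm M (a • w) = a ^ 2 * quadForm M w := by
  simp only [quadForm, map_smul, inner_smul_left, inner_smul_right, conj_trivial]
  ring

theorem quadForm_comp_adjoint {E F : Type*}
    [NormedAddCommGroup E] [InnerProductSpace ℝ E] [FiniteDimensional ℝ E]
    [NormedAddCommGroup F] [InnerProductSpace ℝ F] [FiniteDimensional ℝ F]
    (B : F →ₗ[ℝ] E) (w : E) :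
    quadForm (B ∘ₗ LinearMap.adjoint B) w = ‖LinearMap.adjoint B w‖ ^ 2 := by
  rw [quadForm, LinearMap.comp_apply, ← LinearMap.adjoint_inner_left, real_inner_self_eq_norm_sq]

theorem quadForm_add_smul {E : Type*} [NormedAddCommGroup E] [InnerProductSpace ℝ E]
    {M : E →ₗ[ℝ] E} (hM : M.IsSymmetric) (a v : E) (t : ℝ) :
    quadForm M (a + t • v) = quadForm M a + t * (2 * ⟪M a, v⟫) + t ^ 2 * quadForm M v := by
  have h := hM a v
  rw [quadForm, quadForm, quadForm, map_add, map_smul]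
  simp only [inner_add_left, inner_add_right, inner_smul_left, inner_smul_right, conj_trivial]
  rw [← h, real_inner_comm (M a) v]
  ring

/-- A function lying above its tangent planes and majorized by the quadratic form `M` has a
gradient that is cocoercive relative to `M`, in a three-point form. -/
theorem neg_quarter_quadForm_le_inner_grad_sub {E : Type*}
    [NormedAddCommGroup E] [InnerProductSpace ℝ E]
    {f : E → ℝ} {df : E → E} {M : E →ₗ[ℝ] E}
    (hlow : ∀ w w', f w' + ⟪df w', w - w'⟫ ≤ f w)
    (hup : ∀ w w', f w ≤ f w' + ⟪df w', w - w'⟫ + 1 / 2 * quadForm M (w - w'))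
    (a b c : E) :
    -(1 / 4) * quadForm M (c - a) ≤ ⟪df a - df b, c - b⟫ := by
  set v : E := (1 / 2 : ℝ) • (c - a) with hv
  have h1 := hlow (a + v) b
  have h2 := hup (a + v) a
  have h3 := hlow (b - v) a
  have h4 := hup (b - v) b
  have hq : quadForm M v = 1 / 4 * quadForm M (c - a) := by
    rw [hv, quadForm_smul_right]; norm_num
  have hq' : quadForm M (-v) = quadForm M v := by simp [quadForm]
  have hc : c - b = (a - b) + (2 : ℝ) • v := by
    rw [hv, smul_smul]; norm_num
  rw [add_sub_cancel_left] at h2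
  rw [sub_sub_cancel_left, hq'] at h4
  rw [hc]
  rw [hq] at h2 h4
  simp only [inner_add_right, inner_sub_left, inner_sub_right, inner_smul_right,
    inner_neg_right] at *
  linarith

/-- First-order optimality for the sum of a convex extended-valued function and a function
that is quadratic along every line through the minimizer. -/
theorem ERConvex.subgrad_of_minimizer {E : Type*}
    [NormedAddCommGroup E] [InnerProductSpace ℝ E]
    {p : E → EReal} (hp : ERConvex p) (hbot : ∀ w, p w ≠ ⊥) {φ : E → ℝ} {u g : E}
    (hu : p u ≠ ⊤) (hmin : ∀ w, p u + (φ u : EReal) ≤ p w + (φ w : EReal))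
    (hφ : ∀ v : E, ∃ H : ℝ, ∀ t : ℝ, φ (u + t • v) = φ u + t * ⟪g, v⟫ + t ^ 2 * H) :
    ERSubgrad p u (-g) := by
  intro w
  by_cases hw : p w = ⊤
  · rw [hw]; exact le_top
  obtain ⟨H, hφ⟩ := hφ (w - u)
  lift p u to ℝ using ⟨hu, hbot u⟩ with pu hpu
  lift p w to ℝ using ⟨hw, hbot w⟩ with pw hpw
  have key : ∀ t : ℝ, 0 < t → t ≤ 1 → 0 ≤ pw - pu + ⟪g, w - u⟫ + t * H := by
    intro t ht ht1
    have hc := hp u w (1 - t) t (by linarith) ht.le (by ring)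
    have hpt : (1 - t) • u + t • w = u + t • (w - u) := by module
    have hm := hmin (u + t • (w - u))
    rw [hpt, ← hpu, ← hpw] at hc
    have h := hm.trans (add_le_add_left hc _)
    rw [hφ] at h
    norm_cast at h
    have : 0 ≤ t * (pw - pu + ⟪g, w - u⟫ + t * H) := by linarith
    exact nonneg_of_mul_nonneg_right this ht
  have hlim : Filter.Tendsto (fun t : ℝ => pw - pu + ⟪g, w - u⟫ + t * H)
      (nhdsWithin 0 (Set.Ioi 0)) (nhds (pw - pu + ⟪g, w - u⟫)) := by
    have : Continuous (fun t : ℝ => pw - pu + ⟪g, w - u⟫ + t * H) := by fun_prop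
    simpa using (this.tendsto 0).mono_left nhdsWithin_le_nhds
  have h0 : 0 ≤ pw - pu + ⟪g, w - u⟫ := by
    refine ge_of_tendsto hlim ?_
    filter_upwards [Ioc_mem_nhdsGT (zero_lt_one (α := ℝ))] with t ht
    exact key t ht.1 ht.2
  rw [inner_neg_left]
  norm_cast
  linarith

/-- Monotonicity of the convex subdifferential. -/
theorem ERSubgrad.inner_sub_nonneg {E : Type*} [NormedAddCommGroup E] [InnerProductSpace ℝ E]
    {p : E → EReal} (hbot : ∀ w, p w ≠ ⊥) {a b ga gb : E} (ha : p a ≠ ⊤)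
    (hga : ERSubgrad p a ga) (hgb : ERSubgrad p b gb) : 0 ≤ ⟪ga - gb, a - b⟫ := by
  have h1 := hga b
  have h2 := hgb a
  have hb : p b ≠ ⊤ := by
    intro hb
    rw [hb, EReal.top_add_coe, top_le_iff] at h2
    exact ha h2
  lift p a to ℝ using ⟨ha, hbot a⟩ with pa
  lift p b to ℝ using ⟨hb, hbot b⟩ with pb
  norm_cast at h1 h2
  simp only [inner_sub_left, inner_sub_right] at *
  linarith

/-- Optimality of a majorized proximal step, compared with a stationary point. -/
theorem ERSubgrad.majorized_step_le {E : Type*} [NormedAddCommGroup E] [InnerProductSpace ℝ E]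
    {f : E → ℝ} {df : E → E} {M P : E →ₗ[ℝ] E}
    (hlow : ∀ w w', f w' + ⟪df w', w - w'⟫ ≤ f w)
    (hup : ∀ w w', f w ≤ f w' + ⟪df w', w - w'⟫ + 1 / 2 * quadForm M (w - w'))
    (hP : P.IsSymmetric)
    {p : E → EReal} (hbot : ∀ w, p w ≠ ⊥) {u u' ubar v vbar : E} (hu' : p u' ≠ ⊤)
    (hstep : ERSubgrad p u' (-(df u + v + P (u' - u))))
    (hbar : ERSubgrad p ubar (-(df ubar + vbar))) :
    quadForm P (u' - ubar) - quadForm P (u - ubar) + quadForm P (u' - u)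
      + 2 * ⟪v - vbar, u' - ubar⟫ ≤ 1 / 2 * quadForm M (u' - u) := by
  have h1 := hstep.inner_sub_nonneg hbot hu' hbar
  have h2 := neg_quarter_quadForm_le_inner_grad_sub hlow hup u ubar u'
  have h3 := two_mul_inner_map_sub hP u' u ubar
  have h4 : -(df u + v + P (u' - u)) - -(df ubar + vbar)
      = -((df u - df ubar) + (v - vbar) + P (u' - u)) := by abel
  rw [h4, inner_neg_left, inner_add_left, inner_add_left] at h1
  linarith

/-- Optimality of two consecutive majorized proximal steps. -/
theorem ERSubgrad.two_mul_inner_majorized_steps_le {E : Type*}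
    [NormedAddCommGroup E] [InnerProductSpace ℝ E]
    {f : E → ℝ} {df : E → E} {M P : E →ₗ[ℝ] E}
    (hlow : ∀ w w', f w' + ⟪df w', w - w'⟫ ≤ f w)
    (hup : ∀ w w', f w ≤ f w' + ⟪df w', w - w'⟫ + 1 / 2 * quadForm M (w - w'))
    (hP : P.IsSymmetric) (hMP : ∀ w, 1 / 2 * quadForm M w ≤ quadForm P w)
    {p : E → EReal} (hbot : ∀ w, p w ≠ ⊥) {u₀ u₁ u₂ v₀ v₁ : E} (hu₂ : p u₂ ≠ ⊤)
    (hstep₀ : ERSubgrad p u₁ (-(df u₀ + v₀ + P (u₁ - u₀))))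
    (hstep₁ : ERSubgrad p u₂ (-(df u₁ + v₁ + P (u₂ - u₁)))) :
    2 * ⟪v₁ - v₀, u₂ - u₁⟫ ≤ quadForm P (u₁ - u₀) - quadForm P (u₂ - u₁) := by
  have h1 := hstep₁.inner_sub_nonneg hbot hu₂ hstep₀
  have h2 := neg_quarter_quadForm_le_inner_grad_sub hlow hup u₁ u₀ (u₂ - u₁ + u₀)
  have h3 := hMP (u₂ - u₁ + u₀ - u₁)
  have h4 : -(df u₁ + v₁ + P (u₂ - u₁)) - -(df u₀ + v₀ + P (u₁ - u₀))
      = -((df u₁ - df u₀) + (v₁ - v₀) + P ((u₂ - u₁) - (u₁ - u₀))) := by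
    rw [map_sub P (u₂ - u₁)]; abel
  have h5 := two_mul_inner_map_sub hP (u₂ - u₁) (u₁ - u₀) 0
  rw [h4, inner_neg_left, inner_add_left, inner_add_left] at h1
  rw [add_sub_cancel_right] at h2
  have h6 : u₂ - u₁ + u₀ - u₁ = (u₂ - u₁) - (u₁ - u₀) := by abel
  rw [h6] at h2 h3
  rw [sub_zero, sub_zero] at h5
  linarith

/-- The objective of a majorized proximal subproblem is quadratic along lines. -/
theorem proximal_objective_add_smul {E F : Type*}
    [NormedAddCommGroup E] [InnerProductSpace ℝ E] [FiniteDimensional ℝ E]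
    [NormedAddCommGroup F] [InnerProductSpace ℝ F] [FiniteDimensional ℝ F]
    (A : F →ₗ[ℝ] E) {P : E →ₗ[ℝ] E} (hP : P.IsSymmetric) (σ : ℝ) (l u u₀ v : E) (x d : F)
    (t : ℝ) :
    ⟪u + t • v, l + A x⟫ + σ / 2 * ‖LinearMap.adjoint A (u + t • v) + d‖ ^ 2
        + 1 / 2 * quadForm P (u + t • v - u₀)
      = ⟪u, l + A x⟫ + σ / 2 * ‖LinearMap.adjoint A u + d‖ ^ 2 + 1 / 2 * quadForm P (u - u₀)
        + t * ⟪l + A (x + σ • (LinearMap.adjoint A u + d)) + P (u - u₀), v⟫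
        + t ^ 2 * (σ / 2 * ‖LinearMap.adjoint A v‖ ^ 2 + 1 / 2 * quadForm P v) := by
  have h1 : u + t • v - u₀ = (u - u₀) + t • v := by abel
  have h2 : LinearMap.adjoint A (u + t • v) + d
      = (LinearMap.adjoint A u + d) + t • LinearMap.adjoint A v := by
    rw [map_add, map_smul]; abel
  rw [h1, quadForm_add_smul hP, h2, norm_add_sq_real, norm_smul, mul_pow, Real.norm_eq_abs,
    sq_abs, map_add, map_smul]
  simp only [inner_add_left (𝕜 := ℝ) (E := E), inner_add_right (𝕜 := ℝ) (E := E),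
    inner_smul_left, inner_smul_right, conj_trivial, LinearMap.adjoint_inner_right]
  rw [real_inner_comm v l, real_inner_comm v (A x)]
  ring

/-- The relaxation parameter of the augmented Lagrangian method below the golden ratio. -/
theorem relaxation_nonneg {τ : ℝ} (h0 : 0 < τ) (h1 : τ < (1 + Real.sqrt 5) / 2) :
    0 ≤ 1 - τ + min τ τ⁻¹ ∧ 0 ≤ 5 - τ - 3 * min τ τ⁻¹ := by
  have h5 : Real.sqrt 5 ^ 2 = 5 := Real.sq_sqrt (by norm_num)
  have h5' : 1 < Real.sqrt 5 := Real.lt_sqrt_of_sq_lt (by norm_num)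
  have hτ : τ ^ 2 < τ + 1 := by
    have := sq_lt_sq' (show -Real.sqrt 5 < 2 * τ - 1 by linarith) (by linarith)
    linarith
  have hτ2 : τ < 2 := by nlinarith
  rcases le_total τ 1 with h | h
  · have hm : min τ τ⁻¹ = τ := min_eq_left (h.trans (one_le_inv₀ h0 |>.2 h))
    rw [hm]; constructor <;> linarith
  · have hi : τ⁻¹ ≤ 1 := inv_le_one_of_one_le₀ h
    have hm : min τ τ⁻¹ = τ⁻¹ := min_eq_right (hi.trans h)
    have hmul : τ * τ⁻¹ = 1 := mul_inv_cancel₀ h0.ne'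
    rw [hm]
    constructor <;> nlinarith [inv_pos.2 h0]

/-- The residual estimate that absorbs the cross term between the multiplier step `b` and the
constraint residuals `r`, `r'`. -/
theorem residual_estimate {X : Type*} [NormedAddCommGroup X] [InnerProductSpace ℝ X]
    {τ : ℝ} (h0 : 0 < τ) (h1 : τ < (1 + Real.sqrt 5) / 2) (b r r' : X) :
    (5 - τ - 3 * min τ τ⁻¹) / 4 * (‖r'‖ ^ 2 - ‖r‖ ^ 2)
        + 2 * ((1 - τ + min τ τ⁻¹) / 2) * τ * ‖b‖ ^ 2
        + (1 - τ + min τ τ⁻¹) / 2 * ‖r'‖ ^ 2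
        + 1 / 4 * ((1 - τ + min τ τ⁻¹) / 2) * ‖r' - r‖ ^ 2
      ≤ ‖b‖ ^ 2 + (2 - τ) * ‖r'‖ ^ 2 - 2 * (1 - τ) * ⟪b, r⟫ := by
  have ht := (relaxation_nonneg h0 h1).1
  have hsum : ‖r' - r‖ ^ 2 = 2 * (‖r'‖ ^ 2 + ‖r‖ ^ 2) - ‖r' + r‖ ^ 2 := by
    rw [norm_sub_sq_real, norm_add_sq_real]; ring
  have hp := sq_nonneg ‖r' + r‖
  rw [hsum]
  rcases le_total τ 1 with h | h
  · have hm : min τ τ⁻¹ = τ := min_eq_left (h.trans (one_le_inv₀ h0 |>.2 h))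
    rw [hm]
    have hsq := mul_nonneg (sub_nonneg.2 h) (sq_nonneg ‖b - r‖)
    rw [norm_sub_sq_real] at hsq
    linarith
  · have hm : min τ τ⁻¹ = τ⁻¹ := min_eq_right ((inv_le_one_of_one_le₀ h).trans h)
    rw [hm] at ht ⊢
    have hmul : τ⁻¹ * τ = 1 := inv_mul_cancel₀ h0.ne'
    have hsq := mul_nonneg (mul_nonneg (inv_nonneg.2 h0.le) (sub_nonneg.2 h))
      (sq_nonneg ‖τ • b + r‖)
    rw [norm_add_sq_real, norm_smul, mul_pow, Real.norm_eq_abs, sq_abs, inner_smul_left,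
      conj_trivial] at hsq
    have hp' := mul_nonneg ht hp
    have e : τ⁻¹ * (τ - 1) * (τ ^ 2 * ‖b‖ ^ 2 + 2 * (τ * ⟪b, r⟫) + ‖r‖ ^ 2)
        = τ * (τ - 1) * ‖b‖ ^ 2 + 2 * (τ - 1) * ⟪b, r⟫ + (1 - τ⁻¹) * ‖r‖ ^ 2 := by
      linear_combination ((τ - 1) * τ * ‖b‖ ^ 2 + 2 * (τ - 1) * ⟪b, r⟫ + ‖r‖ ^ 2) * hmul
    rw [e] at hsq
    have e2 : 2 * ((1 - τ + τ⁻¹) / 2) * τ * ‖b‖ ^ 2 = (τ - τ ^ 2 + 1) * ‖b‖ ^ 2 := by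
      linear_combination ‖b‖ ^ 2 * hmul
    rw [e2]
    linarith

/-- The change of the multiplier and residual terms along one step. -/
theorem multiplier_step_identity {X : Type*} [NormedAddCommGroup X] [InnerProductSpace ℝ X]
    {σ τ : ℝ} (hσ : σ ≠ 0) (hτ : τ ≠ 0) (x α β β' : X) :
    2 * ⟪x + σ • (α + β' - (β' - β)), α⟫ + 2 * ⟪x + σ • (α + β'), β'⟫
      = (τ * σ)⁻¹ * (‖x + (τ * σ) • (α + β')‖ ^ 2 - ‖x‖ ^ 2)
        + σ * (‖β'‖ ^ 2 - ‖β‖ ^ 2 + ‖β' - β‖ ^ 2)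
        + (2 - τ) * σ * ‖α + β'‖ ^ 2 - 2 * σ * ⟪β' - β, α + β'⟫ := by
  have hx : (τ * σ)⁻¹ * (‖x + (τ * σ) • (α + β')‖ ^ 2 - ‖x‖ ^ 2)
      = 2 * ⟪x, α + β'⟫ + τ * σ * ‖α + β'‖ ^ 2 := by
    rw [norm_add_sq_real, norm_smul, mul_pow, Real.norm_eq_abs, sq_abs, inner_smul_right]
    field_simp
    ring
  rw [hx]
  simp only [← real_inner_self_eq_norm_sq, inner_add_left, inner_add_right, inner_sub_left,
    inner_sub_right, inner_smul_left, conj_trivial]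
  rw [real_inner_comm α β, real_inner_comm α β', real_inner_comm β β']
  ring

/-- **Proposition 3.1.**  For `τ ∈ (0, (1+√5)/2)` and a sequence generated by the majorized
iPADMM, for every KKT point `ū` and `k ≥ 1`:
`‖u^{k+1} − ū‖²_ℳ + ‖z^{k+1} − z^k‖²_{Σ̂_g+𝒯}
  ≤ ‖u^k − ū‖²_ℳ + ‖z^k − z^{k−1}‖²_{Σ̂_g+𝒯} − ‖u^{k+1} − u^k‖²_ℋ`,
and consequently the same inequality with `‖u^j − ū‖²_ℳ` replaced by `dist²_ℳ(u^j, Ω̄)`. -/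
theorem stmt6 {X Y Z : Type*}
    [NormedAddCommGroup X] [InnerProductSpace ℝ X] [FiniteDimensional ℝ X]
    [NormedAddCommGroup Y] [InnerProductSpace ℝ Y] [FiniteDimensional ℝ Y]
    [NormedAddCommGroup Z] [InnerProductSpace ℝ Z] [FiniteDimensional ℝ Z]
    (A : X →ₗ[ℝ] Y) (B : X →ₗ[ℝ] Z) (c : X)
    (f : Y → ℝ) (g : Z → ℝ) (gradf : Y → Y) (gradg : Z → Z)
    (hfconv : ConvexOn ℝ Set.univ f) (hgconv : ConvexOn ℝ Set.univ g)
    (hfdiff : ∀ w, HasGradientAt f (gradf w) w)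
    (hgdiff : ∀ w, HasGradientAt g (gradg w) w)
    (hfLip : ∃ L : NNReal, LipschitzWith L gradf)
    (hgLip : ∃ L : NNReal, LipschitzWith L gradg)
    (p : Y → EReal) (q : Z → EReal)
    (hpconv : ERConvex p) (hplsc : LowerSemicontinuous p) (hpproper : ERProper p)
    (hqconv : ERConvex q) (hqlsc : LowerSemicontinuous q) (hqproper : ERProper q)
    (Sf Sfh : Y →ₗ[ℝ] Y) (Sg Sgh : Z →ₗ[ℝ] Z)
    (hSfsym : Sf.IsSymmetric) (hSfh_sym : Sfh.IsSymmetric)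
    (hSgsym : Sg.IsSymmetric) (hSghsym : Sgh.IsSymmetric)
    (hSfpos : ∀ w, 0 ≤ quadForm Sf w) (hSfhpos : ∀ w, 0 ≤ quadForm Sfh w)
    (hSgpos : ∀ w, 0 ≤ quadForm Sg w) (hSghpos : ∀ w, 0 ≤ quadForm Sgh w)
    (hSfle : ∀ w, quadForm Sf w ≤ quadForm Sfh w)
    (hSgle : ∀ w, quadForm Sg w ≤ quadForm Sgh w)
    (hfmaj : ∀ w w' : Y,
      f w' + ⟪gradf w', w - w'⟫ + 1 / 2 * quadForm Sf (w - w') ≤ f w ∧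
      f w ≤ f w' + ⟪gradf w', w - w'⟫ + 1 / 2 * quadForm Sfh (w - w'))
    (hgmaj : ∀ w w' : Z,
      g w' + ⟪gradg w', w - w'⟫ + 1 / 2 * quadForm Sg (w - w') ≤ g w ∧
      g w ≤ g w' + ⟪gradg w', w - w'⟫ + 1 / 2 * quadForm Sgh (w - w'))
    (σ τ : ℝ) (hσ : 0 < σ) (hτ : 0 < τ ∧ τ < (1 + Real.sqrt 5) / 2)
    (S : Y →ₗ[ℝ] Y) (T : Z →ₗ[ℝ] Z)
    (hSsym : S.IsSymmetric) (hTsym : T.IsSymmetric)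
    (hS : ∀ w, -(1 / 2) * quadForm Sfh w ≤ quadForm S w)
    (hT : ∀ w, -(1 / 2) * quadForm Sgh w ≤ quadForm T w)
    (y : ℕ → Y) (z : ℕ → Z) (x : ℕ → X)
    (hdomp : ∀ k, p (y k) ≠ ⊤) (hdomq : ∀ k, q (z k) ≠ ⊤)
    (hsubY : ∀ k, ∀ w : Y,
      p (y (k + 1)) + ((⟪y (k + 1), gradf (y k) + A (x k)⟫
          + σ / 2 * ‖LinearMap.adjoint A (y (k + 1)) + LinearMap.adjoint B (z k) - c‖ ^ 2
          + 1 / 2 * quadForm (Sfh + S) (y (k + 1) - y k) : ℝ) : EReal)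
      ≤ p w + ((⟪w, gradf (y k) + A (x k)⟫
          + σ / 2 * ‖LinearMap.adjoint A w + LinearMap.adjoint B (z k) - c‖ ^ 2
          + 1 / 2 * quadForm (Sfh + S) (w - y k) : ℝ) : EReal))
    (hsubZ : ∀ k, ∀ w : Z,
      q (z (k + 1)) + ((⟪z (k + 1), gradg (z k) + B (x k)⟫
          + σ / 2 * ‖LinearMap.adjoint A (y (k + 1)) + LinearMap.adjoint B (z (k + 1)) - c‖ ^ 2
          + 1 / 2 * quadForm (Sgh + T) (z (k + 1) - z k) : ℝ) : EReal)
      ≤ q w + ((⟪w, gradg (z k) + B (x k)⟫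
          + σ / 2 * ‖LinearMap.adjoint A (y (k + 1)) + LinearMap.adjoint B w - c‖ ^ 2
          + 1 / 2 * quadForm (Sgh + T) (w - z k) : ℝ) : EReal))
    (hxup : ∀ k, x (k + 1)
      = x k + (τ * σ) • (LinearMap.adjoint A (y (k + 1)) + LinearMap.adjoint B (z (k + 1)) - c))
    (hKKTne : (KKTset A B c gradf gradg p q).Nonempty) :
    ∀ k : ℕ, 1 ≤ k →
      let sτ : ℝ := (5 - τ - 3 * min τ τ⁻¹) / 4
      let tτ : ℝ := (1 - τ + min τ τ⁻¹) / 2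
      let quadM : Y → Z → X → ℝ := fun dy dz dx =>
        quadForm (Sfh + S) dy
          + quadForm (Sgh + T + σ • (B ∘ₗ LinearMap.adjoint B)) dz
          + (τ * σ)⁻¹ * ‖dx‖ ^ 2
          + sτ * σ * ‖LinearMap.adjoint A dy + LinearMap.adjoint B dz‖ ^ 2
      let quadH : Y → Z → X → ℝ := fun dy dz dx =>
        quadForm ((1 / 2 : ℝ) • Sfh + S) dy
          + quadForm ((1 / 2 : ℝ) • Sgh + T + (2 * tτ * τ * σ) • (B ∘ₗ LinearMap.adjoint B)) dz
          + tτ * (τ ^ 2 * σ)⁻¹ * ‖dx‖ ^ 2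
          + 1 / 4 * tτ * σ * ‖LinearMap.adjoint A dy + LinearMap.adjoint B dz‖ ^ 2
      let distSqM : ℕ → ℝ := fun j =>
        sInf ((fun w : Y × Z × X => quadM (y j - w.1) (z j - w.2.1) (x j - w.2.2))
          '' KKTset A B c gradf gradg p q)
      (∀ ybar zbar xbar, (ybar, zbar, xbar) ∈ KKTset A B c gradf gradg p q →
        quadM (y (k + 1) - ybar) (z (k + 1) - zbar) (x (k + 1) - xbar)
            + quadForm (Sgh + T) (z (k + 1) - z k)
          ≤ quadM (y k - ybar) (z k - zbar) (x k - xbar)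
            + quadForm (Sgh + T) (z k - z (k - 1))
            - quadH (y (k + 1) - y k) (z (k + 1) - z k) (x (k + 1) - x k)) ∧
      distSqM (k + 1) + quadForm (Sgh + T) (z (k + 1) - z k)
        ≤ distSqM k + quadForm (Sgh + T) (z k - z (k - 1))
          - quadH (y (k + 1) - y k) (z (k + 1) - z k) (x (k + 1) - x k) := by
  intro k hk sτ tτ quadM quadH distSqM
  obtain ⟨hτ0, hτ1⟩ := hτ
  have hpbot := hpproper.2
  have hqbot := hqproper.2
  have hflow : ∀ w w' : Y, f w' + ⟪gradf w', w - w'⟫ ≤ f w := fun w w' => by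
    linarith [(hfmaj w w').1, hSfpos (w - w')]
  have hglow : ∀ w w' : Z, g w' + ⟪gradg w', w - w'⟫ ≤ g w := fun w w' => by
    linarith [(hgmaj w w').1, hSgpos (w - w')]
  have hfup := fun w w' : Y => (hfmaj w w').2
  have hgup := fun w w' : Z => (hgmaj w w').2
  have hPsym : (Sfh + S).IsSymmetric := hSfh_sym.add hSsym
  have hQsym : (Sgh + T).IsSymmetric := hSghsym.add hTsym
  have hP : ∀ w, 1 / 2 * quadForm Sfh w ≤ quadForm (Sfh + S) w := fun w => by
    rw [quadForm_add]; linarith [hS w]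
  have hQ : ∀ w, 1 / 2 * quadForm Sgh w ≤ quadForm (Sgh + T) w := fun w => by
    rw [quadForm_add]; linarith [hT w]
  have optY : ∀ k, ERSubgrad p (y (k + 1)) (-(gradf (y k) + A (x k + σ •
      (LinearMap.adjoint A (y (k + 1)) + (LinearMap.adjoint B (z k) - c)))
      + (Sfh + S) (y (k + 1) - y k))) := fun k => by
    refine hpconv.subgrad_of_minimizer hpbot (φ := fun w =>
      ⟪w, gradf (y k) + A (x k)⟫
        + σ / 2 * ‖LinearMap.adjoint A w + LinearMap.adjoint B (z k) - c‖ ^ 2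
        + 1 / 2 * quadForm (Sfh + S) (w - y k)) (hdomp _) (hsubY k)
      fun v => ⟨σ / 2 * ‖LinearMap.adjoint A v‖ ^ 2 + 1 / 2 * quadForm (Sfh + S) v, fun t => ?_⟩
    simp only [add_sub_assoc]
    simpa only [add_sub_assoc] using proximal_objective_add_smul A hPsym σ (gradf (y k))
      (y (k + 1)) (y k) v (x k) (LinearMap.adjoint B (z k) - c) t
  have optZ : ∀ k, ERSubgrad q (z (k + 1)) (-(gradg (z k) + B (x k + σ •
      (LinearMap.adjoint B (z (k + 1)) + (LinearMap.adjoint A (y (k + 1)) - c)))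
      + (Sgh + T) (z (k + 1) - z k))) := fun k => by
    refine hqconv.subgrad_of_minimizer hqbot (φ := fun w =>
      ⟪w, gradg (z k) + B (x k)⟫
        + σ / 2 * ‖LinearMap.adjoint A (y (k + 1)) + LinearMap.adjoint B w - c‖ ^ 2
        + 1 / 2 * quadForm (Sgh + T) (w - z k)) (hdomq _) (hsubZ k)
      fun v => ⟨σ / 2 * ‖LinearMap.adjoint B v‖ ^ 2 + 1 / 2 * quadForm (Sgh + T) v, fun t => ?_⟩
    have e : ∀ w : Z, LinearMap.adjoint A (y (k + 1)) + LinearMap.adjoint B w - c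
        = LinearMap.adjoint B w + (LinearMap.adjoint A (y (k + 1)) - c) := fun w => by abel
    simp only [e]
    exact proximal_objective_add_smul B hQsym σ (gradg (z k))
      (z (k + 1)) (z k) v (x k) (LinearMap.adjoint A (y (k + 1)) - c) t
  have main : ∀ ybar zbar xbar, (ybar, zbar, xbar) ∈ KKTset A B c gradf gradg p q →
      quadM (y (k + 1) - ybar) (z (k + 1) - zbar) (x (k + 1) - xbar)
          + quadForm (Sgh + T) (z (k + 1) - z k)
        ≤ quadM (y k - ybar) (z k - zbar) (x k - xbar)
          + quadForm (Sgh + T) (z k - z (k - 1))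
          - quadH (y (k + 1) - y k) (z (k + 1) - z k) (x (k + 1) - x k) := by
    rintro ybar zbar xbar ⟨hKy, hKz, hKc⟩
    dsimp only at hKy hKz hKc
    have hY := (optY k).majorized_step_le hflow hfup hPsym hpbot (hdomp _) hKy
    have hZ := (optZ k).majorized_step_le hglow hgup hQsym hqbot (hdomq _) hKz
    obtain ⟨j, rfl⟩ : ∃ j, k = j + 1 := ⟨k - 1, by omega⟩
    have hZZ := ERSubgrad.two_mul_inner_majorized_steps_le hglow hgup hQsym hQ hqbot (hdomq _)
      (optZ j) (optZ (j + 1))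
    rw [Nat.add_sub_cancel]
    set α' := LinearMap.adjoint A (y (j + 1 + 1) - ybar) with hα'
    set α := LinearMap.adjoint A (y (j + 1) - ybar) with hα
    set β' := LinearMap.adjoint B (z (j + 1 + 1) - zbar) with hβ'
    set β := LinearMap.adjoint B (z (j + 1) - zbar) with hβ
    have hr' : LinearMap.adjoint A (y (j + 1 + 1)) + LinearMap.adjoint B (z (j + 1 + 1)) - c
        = α' + β' := by
      rw [hα', hβ', map_sub, map_sub, ← hKc]; abel
    have hr : LinearMap.adjoint A (y (j + 1)) + LinearMap.adjoint B (z (j + 1)) - c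
        = α + β := by
      rw [hα, hβ, map_sub, map_sub, ← hKc]; abel
    have hb : LinearMap.adjoint B (z (j + 1 + 1) - z (j + 1)) = β' - β := by
      rw [hβ', hβ, ← map_sub, sub_sub_sub_cancel_right]
    have ha : LinearMap.adjoint A (y (j + 1 + 1) - y (j + 1)) = α' - α := by
      rw [hα', hα, ← map_sub, sub_sub_sub_cancel_right]
    have hx' : x (j + 1 + 1) - xbar = x (j + 1) - xbar + (τ * σ) • (α' + β') := by
      rw [hxup, hr']; abel
    have hdx : x (j + 1 + 1) - x (j + 1) = (τ * σ) • (α' + β') := by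
      rw [hxup, hr']; abel
    have eY : x (j + 1) + σ • (LinearMap.adjoint A (y (j + 1 + 1))
        + (LinearMap.adjoint B (z (j + 1)) - c)) - xbar
        = x (j + 1) - xbar + σ • (α' + β' - (β' - β)) := by
      rw [← hr', ← hb, map_sub]
      module
    have eZ : x (j + 1) + σ • (LinearMap.adjoint B (z (j + 1 + 1))
        + (LinearMap.adjoint A (y (j + 1 + 1)) - c)) - xbar
        = x (j + 1) - xbar + σ • (α' + β') := by
      rw [← hr']
      module
    have eZZ : x (j + 1) + σ • (LinearMap.adjoint B (z (j + 1 + 1))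
          + (LinearMap.adjoint A (y (j + 1 + 1)) - c))
        - (x j + σ • (LinearMap.adjoint B (z (j + 1)) + (LinearMap.adjoint A (y (j + 1)) - c)))
        = σ • (α' + β') - ((1 - τ) * σ) • (α + β) := by
      rw [← hr', ← hr, hxup j]
      module
    rw [← map_sub, ← LinearMap.adjoint_inner_right, eY, ← hα'] at hY
    rw [← map_sub, ← LinearMap.adjoint_inner_right, eZ, ← hβ'] at hZ
    rw [← map_sub, ← LinearMap.adjoint_inner_right, eZZ, hb, inner_sub_left, inner_smul_left,
      inner_smul_left, conj_trivial, conj_trivial, real_inner_comm, real_inner_comm _ (α + β)]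
      at hZZ
    have hX := multiplier_step_identity hσ.ne' hτ0.ne' (x (j + 1) - xbar) α' β β'
    have hR := mul_le_mul_of_nonneg_left
      (residual_estimate hτ0 hτ1 (β' - β) (α + β) (α' + β')) hσ.le
    have hdx2 : tτ * (τ ^ 2 * σ)⁻¹ * ‖(τ * σ) • (α' + β')‖ ^ 2
        = tτ * σ * ‖α' + β'‖ ^ 2 := by
      rw [norm_smul, mul_pow, Real.norm_eq_abs, sq_abs]
      field_simp
    have hrr : α' - α + (β' - β) = α' + β' - (α + β) := by abel
    simp only [quadM, quadH, hx', hdx, hdx2, ha, hb, hrr, ← hα', ← hα, ← hβ', ← hβ]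
    simp only [quadForm_add, quadForm_smul, quadForm_comp_adjoint, hb, ← hβ', ← hβ] at *
    simp only [sτ, tτ]
    linarith
  refine ⟨main, ?_⟩
  have hM0 : ∀ dy dz dx, 0 ≤ quadM dy dz dx := fun dy dz dx => by
    have h1 := hP dy
    have h2 := hQ dz
    have h3 := hSfhpos dy
    have h4 := hSghpos dz
    have hs : 0 ≤ sτ := div_nonneg (relaxation_nonneg hτ0 hτ1).2 (by norm_num)
    simp only [quadM]
    rw [quadForm_add (Sgh + T), quadForm_smul, quadForm_comp_adjoint]
    have h5 : 0 ≤ quadForm (Sfh + S) dy := by linarith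
    have h6 : 0 ≤ quadForm (Sgh + T) dz := by linarith
    positivity
  have hinf : distSqM (k + 1) + quadForm (Sgh + T) (z (k + 1) - z k)
      - quadForm (Sgh + T) (z k - z (k - 1))
      + quadH (y (k + 1) - y k) (z (k + 1) - z k) (x (k + 1) - x k) ≤ distSqM k := by
    refine le_csInf (hKKTne.image _) ?_
    rintro _ ⟨⟨ybar, zbar, xbar⟩, hw, rfl⟩
    have hle : distSqM (k + 1)
        ≤ quadM (y (k + 1) - ybar) (z (k + 1) - zbar) (x (k + 1) - xbar) := by
      refine csInf_le ⟨0, ?_⟩ ⟨(ybar, zbar, xbar), hw, rfl⟩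
      rintro _ ⟨w, -, rfl⟩
      exact hM0 _ _ _
    have hmain := main ybar zbar xbar hw
    dsimp only at hle hmain ⊢
    linarith
  linarith

end
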